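/- arXiv:1603.04532 — 4 statements merged into one kernel-verified Lean document; each statement's English description precedes it below -/
import Mathlib

section
/- For every integer l ≥ 2 and every real number t, the identity N_{B_l}(t) = (1/(l−1)!)·d^{l−1}/dt^{l−1}[ t^{l−1} (1−t)^l ] holds; that is, the polynomial N_{B_l}(t) equals 1/(l−1)! times the (l−1)-st derivative of the polynomial t^{l−1}(1−t)^l. (Rodrigues type formula for type B_l.) -/
open Polynomial

/-- The skew-growth function of the dual Artin monoid of type `B_l`:
`N_{B_l}(t) = ∑_{k=0}^{l} (−1)^k·C(l,k)·C(l+k−1,k)·t^k`. -/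
noncomputable def NB (l : ℕ) : Polynomial ℝ :=
  ∑ k ∈ Finset.range (l + 1),
    Polynomial.C ((-1 : ℝ) ^ k * (l.choose k : ℝ) * ((l + k - 1).choose k : ℝ)) * X ^ k

theorem X_pow_mul_one_sub_X_pow_eq_sum {R : Type*} [CommRing R] (m n : ℕ) :
    (X ^ m * (1 - X) ^ n : R[X]) =
      ∑ k ∈ Finset.range (n + 1), C ((-1) ^ k * (n.choose k : R)) * X ^ (m + k) := by
  rw [sub_eq_add_neg, add_comm (1 : R[X]), add_pow, Finset.mul_sum]
  refine Finset.sum_congr rfl fun k _ => ?_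
  rw [neg_pow, one_pow, pow_add]
  simp only [map_mul, map_pow, map_neg, map_one, map_natCast]
  ring

theorem iterate_derivative_X_pow_mul_one_sub_X_pow {R : Type*} [CommRing R] (m n : ℕ) :
    derivative^[m] (X ^ m * (1 - X) ^ n : R[X]) =
      C (m.factorial : R) * ∑ k ∈ Finset.range (n + 1),
        C ((-1) ^ k * (n.choose k : R) * ((m + k).choose k : R)) * X ^ k := by
  rw [X_pow_mul_one_sub_X_pow_eq_sum, iterate_derivative_sum, Finset.mul_sum]
  refine Finset.sum_congr rfl fun k _ => ?_
  rw [iterate_derivative_C_mul, iterate_derivative_X_pow_eq_C_mul, Nat.add_sub_cancel_left,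
    Nat.descFactorial_eq_factorial_mul_choose, Nat.choose_symm_add]
  simp only [map_mul, Nat.cast_mul]
  ring

/-- Rodrigues type formula for type `B_l`:
`N_{B_l}(t) = (1/(l−1)!)·(d/dt)^{l−1}[ t^{l−1} (1−t)^l ]`. -/
theorem rodrigues_B (l : ℕ) (hl : 2 ≤ l) (t : ℝ) :
    (NB l).eval t =
      (1 / (Nat.factorial (l - 1) : ℝ)) *
        (derivative^[l - 1] (X ^ (l - 1) * (1 - X) ^ l : Polynomial ℝ)).eval t := by
  have h_sum : derivative^[l - 1] (X ^ (l - 1) * (1 - X) ^ l : ℝ[X]) =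
      C ((l - 1).factorial : ℝ) * NB l := by
    rw [iterate_derivative_X_pow_mul_one_sub_X_pow, NB]
    congr 1
    refine Finset.sum_congr rfl fun k _ => ?_
    rw [Nat.sub_add_comm (one_le_two.trans hl)]
  rw [h_sum, eval_mul, eval_C, one_div,
    inv_mul_cancel_left₀ (Nat.cast_ne_zero.mpr (Nat.factorial_ne_zero _))]
end

section
/- For every integer l ≥ 1, the polynomial N_{A_l} has degree l, satisfies N_{A_l}(1) = 0, and has exactly l distinct real roots, all of which lie in the half-open interval (0,1]; consequently every root of N_{A_l} is real, simple, and lies in (0,1]. -/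
open Polynomial

/-- The skew-growth function of the dual Artin monoid of type `A_l`:
`N_{A_l}(t) = ∑_{k=0}^{l} (−1)^k (1/l)·C(l,k)·C(l+k,k+1)·t^k`. -/
noncomputable def NA (l : ℕ) : Polynomial ℝ :=
  ∑ k ∈ Finset.range (l + 1),
    Polynomial.C ((-1 : ℝ) ^ k * (1 / (l : ℝ)) * (l.choose k : ℝ) *
      ((l + k).choose (k + 1) : ℝ)) * X ^ k

lemma coeff_NA (l k : ℕ) :
    (NA l).coeff k = if k ≤ l then (-1 : ℝ) ^ k * (1 / (l : ℝ)) * (l.choose k : ℝ) *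
      ((l + k).choose (k + 1) : ℝ) else 0 := by
  simp only [NA, finsetSum_coeff, coeff_C_mul_X_pow]
  rw [Finset.sum_ite_eq]
  simp

lemma natDegree_NA {l : ℕ} (hl : 1 ≤ l) : (NA l).natDegree = l := by
  refine natDegree_eq_of_le_of_coeff_ne_zero ?_ ?_
  · rw [natDegree_le_iff_coeff_eq_zero]
    intro k hk
    simp [coeff_NA, hk]
  · have h : (l + l).choose (l + 1) ≠ 0 := (Nat.choose_pos (by lia)).ne'
    have hl' : (l : ℝ) ≠ 0 := by positivity
    simp only [coeff_NA, le_refl, if_true, Nat.choose_self]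
    have : ((l + l).choose (l + 1) : ℝ) ≠ 0 := by exact_mod_cast h
    simp [hl', this]

/-- A Rodrigues formula for the polynomial `NA l`. -/
lemma iterate_derivative_eq_X_mul_NA (n : ℕ) :
    derivative^[n] (X ^ (n + 1) * (1 - (X : ℝ[X])) ^ (n + 1)) =
      C ((n + 1).factorial : ℝ) * (X * NA (n + 1)) := by
  have h : X ^ (n + 1) * (1 - (X : ℝ[X])) ^ (n + 1) = ∑ k ∈ Finset.range (n + 1 + 1),
      C ((-1 : ℝ) ^ k * (n + 1).choose k) * X ^ (n + 1 + k) := by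
    rw [sub_eq_neg_add, add_pow, Finset.mul_sum]
    refine Finset.sum_congr rfl fun k _ ↦ ?_
    simp only [neg_pow (X : ℝ[X]), one_pow, map_mul, map_pow, map_neg, map_one, map_natCast]
    ring
  rw [h, iterate_derivative_sum, NA, Finset.mul_sum, Finset.mul_sum]
  refine Finset.sum_congr rfl fun k _ ↦ ?_
  have hd : ((n + 1 + k).descFactorial n : ℝ) =
      n.factorial * ((n + 1 + k).choose (k + 1) : ℝ) := by
    rw [Nat.descFactorial_eq_factorial_mul_choose,
      ← Nat.choose_symm_of_eq_add (show n + 1 + k = n + (k + 1) by lia)]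
    push_cast
    rfl
  rw [iterate_derivative_C_mul, iterate_derivative_X_pow_eq_C_mul,
    show n + 1 + k - n = k + 1 by lia, hd, Nat.factorial_succ, ← mul_assoc, ← C_mul, pow_succ',
    mul_left_comm X, ← mul_assoc (C _) (C _), ← C_mul]
  congr 2
  push_cast
  field_simp

/-- Rolle's theorem for polynomials, with roots of `p` separated by roots of the derivative. -/
lemma exists_isRoot_derivative {p : ℝ[X]} {a b : ℝ} (hab : a < b) (ha : p.IsRoot a)
    (hb : p.IsRoot b) : ∃ c ∈ Set.Ioo a b, (derivative p).IsRoot c := by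
  obtain ⟨c, hc, h⟩ := exists_deriv_eq_zero hab p.continuousOn (ha.trans hb.symm)
  exact ⟨c, hc, by simpa using h⟩

lemma isRoot_iterate_derivative_of_pow_dvd {p : ℝ[X]} {a : ℝ} {j l : ℕ} (hj : j < l)
    (h : (X - C a) ^ l ∣ p) : (derivative^[j] p).IsRoot a :=
  dvd_iff_isRoot.mp <| (dvd_pow_self _ (by lia)).trans
    (pow_sub_dvd_iterate_derivative_of_pow_dvd j h)

/-- If `a < b` are roots of multiplicity at least `l` of `p`, then for `j < l` the `j`-th derivative
of `p` vanishes at `a`, at `b`, and at `j` further points between them. -/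
lemma exists_roots_iterate_derivative {p : ℝ[X]} {a b : ℝ} {l : ℕ} (hab : a < b)
    (ha : (X - C a) ^ l ∣ p) (hb : (X - C b) ^ l ∣ p) (j : ℕ) (hj : j < l) :
    ∃ g : ℕ → ℝ, g 0 = a ∧ g (j + 1) = b ∧ (∀ i ≤ j, g i < g (i + 1)) ∧
      ∀ i ≤ j + 1, (derivative^[j] p).IsRoot (g i) := by
  induction j with
  | zero =>
    refine ⟨fun i ↦ if i = 0 then a else b, by simp, by simp, by simpa using hab, fun i _ ↦ ?_⟩
    dsimp only
    split_ifs
    · exact isRoot_iterate_derivative_of_pow_dvd hj ha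
    · exact isRoot_iterate_derivative_of_pow_dvd hj hb
  | succ j ih =>
    obtain ⟨g, g0, g1, hg, hr⟩ := ih (by lia)
    have key : ∀ i, ∃ c, i ≤ j →
        c ∈ Set.Ioo (g i) (g (i + 1)) ∧ (derivative^[j + 1] p).IsRoot c := by
      intro i
      by_cases hi : i ≤ j
      · obtain ⟨c, hc, h⟩ :=
          exists_isRoot_derivative (hg i hi) (hr i (by lia)) (hr (i + 1) (by lia))
        exact ⟨c, fun _ ↦ ⟨hc, by rwa [Function.iterate_succ_apply']⟩⟩
      · exact ⟨0, fun h ↦ absurd h hi⟩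
    choose c hc using key
    refine ⟨fun i ↦ if i = 0 then a else if i = j + 2 then b else c (i - 1),
      by simp, by simp, fun i hi ↦ ?_, fun i hi ↦ ?_⟩
    · rcases i with _ | i
      · simpa [g0] using (hc 0 (by lia)).1.1
      · have h₁ := (hc i (by lia)).1.2
        by_cases h : i = j
        · subst h
          simpa [g1] using h₁
        · have h₂ := (hc (i + 1) (by lia)).1.1
          simpa [h, show i ≠ j + 1 by lia] using h₁.trans h₂
    · dsimp only
      split_ifs with h₁ h₂
      · exact isRoot_iterate_derivative_of_pow_dvd hj ha
      · exact isRoot_iterate_derivative_of_pow_dvd hj hb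
      · exact (hc (i - 1) (by lia)).2

lemma exists_finset_roots_NA {l : ℕ} (hl : 1 ≤ l) :
    ∃ S : Finset ℝ, S.card = l ∧ 1 ∈ S ∧ ∀ r ∈ S, r ∈ Set.Ioc (0 : ℝ) 1 ∧ (NA l).IsRoot r := by
  obtain ⟨n, rfl⟩ : ∃ n, l = n + 1 := ⟨l - 1, by lia⟩
  have ha : (X - C (0 : ℝ)) ^ (n + 1) ∣ X ^ (n + 1) * (1 - (X : ℝ[X])) ^ (n + 1) := by simp
  have hb : (X - C (1 : ℝ)) ^ (n + 1) ∣ X ^ (n + 1) * (1 - (X : ℝ[X])) ^ (n + 1) :=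
    (pow_dvd_pow_of_dvd ⟨-1, by simp⟩ _).mul_left _
  obtain ⟨g, g0, g1, hg, hr⟩ :=
    exists_roots_iterate_derivative zero_lt_one ha hb n n.lt_succ_self
  have hmono : StrictMonoOn g (Set.Iic (n + 1)) :=
    strictMonoOn_Iic_of_lt_succ fun i hi ↦ hg i (by lia)
  refine ⟨(Finset.Icc 1 (n + 1)).image g, ?_, ?_, ?_⟩
  · rw [Finset.card_image_of_injOn, Nat.card_Icc, Nat.add_sub_cancel]
    exact hmono.injOn.mono fun i hi ↦ (Finset.mem_Icc.mp hi).2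
  · exact Finset.mem_image.mpr ⟨n + 1, by simp, g1⟩
  · intro r h
    obtain ⟨i, hi, rfl⟩ := Finset.mem_image.mp h
    rw [Finset.mem_Icc] at hi
    have hpos : 0 < g i := by
      rw [← g0]
      exact hmono (by simp) (by simpa using hi.2) (by lia)
    have hle : g i ≤ 1 := by
      rw [← g1]
      exact hmono.monotoneOn (by simpa using hi.2) (by simp) hi.2
    refine ⟨⟨hpos, hle⟩, ?_⟩
    have h := hr i hi.2
    rw [iterate_derivative_eq_X_mul_NA] at h
    simpa [hpos.ne', Nat.factorial_ne_zero] using h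

/-- A finite set of roots with as many elements as the degree is the full multiset of roots. -/
lemma roots_eq_val_of_card_eq_natDegree {p : ℝ[X]} (hp : p ≠ 0) {S : Finset ℝ}
    (hS : ∀ r ∈ S, p.IsRoot r) (hcard : S.card = p.natDegree) : p.roots = S.val := by
  refine (Multiset.eq_of_le_of_card_le ?_ ?_).symm
  · exact (Finset.val_le_iff_val_subset).mpr fun r hr ↦ (mem_roots hp).mpr (hS r hr)
  · exact p.card_roots'.trans hcard.ge

/-- `N_{A_l}` has degree `l`, satisfies `N_{A_l}(1) = 0`, and has exactly `l` distinct
real roots, all in `(0,1]`; every root is real, simple, and lies in `(0,1]`. -/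
theorem roots_A (l : ℕ) (hl : 1 ≤ l) :
    (NA l).natDegree = l ∧ (NA l).eval 1 = 0 ∧
    ∃ S : Finset ℝ, S.card = l ∧ (∀ r ∈ S, r ∈ Set.Ioc (0 : ℝ) 1) ∧
      (∀ r : ℝ, (NA l).eval r = 0 ↔ r ∈ S) ∧
      (∀ r ∈ S, Polynomial.rootMultiplicity r (NA l) = 1) ∧
      (∀ z : ℂ, Polynomial.aeval z (NA l) = 0 → ∃ r : ℝ, (r : ℂ) = z ∧ r ∈ Set.Ioc (0 : ℝ) 1) := by
  obtain ⟨S, hcard, hone, hS⟩ := exists_finset_roots_NA hl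
  have hdeg := natDegree_NA hl
  have hne : NA l ≠ 0 := by
    intro h
    rw [h, natDegree_zero] at hdeg
    lia
  have hroots : (NA l).roots = S.val :=
    roots_eq_val_of_card_eq_natDegree hne (fun r hr ↦ (hS r hr).2) (hcard.trans hdeg.symm)
  refine ⟨hdeg, (hS 1 hone).2, S, hcard, fun r hr ↦ (hS r hr).1, fun r ↦ ?_, fun r hr ↦ ?_,
    fun z hz ↦ ?_⟩
  · rw [← IsRoot.def, ← mem_roots hne, hroots, Finset.mem_val]
  · rw [← count_roots, hroots, Multiset.count_eq_one_of_mem S.nodup hr]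
  · have hprod := C_leadingCoeff_mul_prod_multiset_X_sub_C
      (p := NA l) (by rw [hroots, hdeg, ← hcard]; rfl)
    rw [hroots] at hprod
    change C (NA l).leadingCoeff * ∏ r ∈ S, (X - C r) = NA l at hprod
    rw [← hprod] at hz
    simp only [map_mul, map_prod, map_sub, aeval_X, aeval_C, mul_eq_zero] at hz
    rcases hz with h | h
    · simp [hne] at h
    · obtain ⟨r, hr, h⟩ := Finset.prod_eq_zero_iff.mp h
      exact ⟨r, (sub_eq_zero.mp h).symm, (hS r hr).1⟩
end

section
/- For every integer l ≥ 2, the polynomial N_{B_l} has degree l, satisfies N_{B_l}(1) = 0, and has exactly l distinct real roots, all of which lie in the half-open interval (0,1]; consequently every root of N_{B_l} is real, simple, and lies in (0,1]. -/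
open Polynomial

open scoped Nat

theorem cast_choose_succ_mul (n k : ℕ) :
    (n.choose (k + 1) : ℝ) * (k + 1) = n.choose k * (n - k) := by
  rcases le_or_gt k n with hk | hk
  · have := Nat.choose_succ_right_eq n k
    rw [← Nat.cast_sub hk]
    exact_mod_cast this
  · simp [Nat.choose_eq_zero_of_lt hk, Nat.choose_eq_zero_of_lt (hk.trans (Nat.lt_succ_self k))]

theorem NB_coeff (l k : ℕ) :
    (NB l).coeff k = (-1 : ℝ) ^ k * (l.choose k : ℝ) * ((l + k - 1).choose k : ℝ) := by
  rw [NB, finsetSum_coeff]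
  simp_rw [coeff_C_mul_X_pow]
  simp +contextual [Nat.choose_eq_zero_of_lt]

theorem NB_natDegree {l : ℕ} (hl : 1 ≤ l) : (NB l).natDegree = l := by
  refine natDegree_eq_of_le_of_coeff_ne_zero ?_ ?_
  · rw [natDegree_le_iff_coeff_eq_zero]
    intro k hk
    simp [NB_coeff, Nat.choose_eq_zero_of_lt hk]
  · simp [NB_coeff, (Nat.choose_pos (show l ≤ l + l - 1 by omega)).ne']

theorem NB_coeff_succ {l : ℕ} (hl : 1 ≤ l) (k : ℕ) :
    ((k : ℝ) + 1) ^ 2 * (NB l).coeff (k + 1) = ((k : ℝ) ^ 2 - (l : ℝ) ^ 2) * (NB l).coeff k := by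
  have h₁ := cast_choose_succ_mul l k
  have h₂ : ((l + k).choose (k + 1) : ℝ) * (k + 1) = (l + k - 1).choose k * (l + k) := by
    have := Nat.add_one_mul_choose_eq (l + k - 1) k
    rw [show l + k - 1 + 1 = l + k by omega] at this
    rw [mul_comm ((l + k - 1).choose k : ℝ)]
    exact_mod_cast this.symm
  rw [NB_coeff, NB_coeff, show l + (k + 1) - 1 = l + k by omega, pow_succ]
  linear_combination (-(-1) ^ k * ((l + k).choose (k + 1) : ℝ) * (k + 1)) * h₁
    - (-1) ^ k * (l.choose k : ℝ) * (l - k) * h₂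

/-- The hypergeometric differential equation `t (1 - t) y'' + (1 - t) y' + l² y = 0`. -/
theorem NB_differential_equation {l : ℕ} (hl : 1 ≤ l) :
    X * (1 - X) * derivative (derivative (NB l)) + (1 - X) * derivative (NB l)
      + C ((l : ℝ) ^ 2) * NB l = 0 := by
  ext k
  have h := NB_coeff_succ hl k
  rw [show X * (1 - X) * derivative (derivative (NB l)) + (1 - X) * derivative (NB l)
      + C ((l : ℝ) ^ 2) * NB l = X * derivative (derivative (NB l))
      - X * (X * derivative (derivative (NB l))) + derivative (NB l) - X * derivative (NB l)
      + C ((l : ℝ) ^ 2) * NB l by ring]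
  rcases k with _ | _ | k <;>
  · simp [coeff_derivative, -map_pow] at h ⊢
    linarith

theorem NB_eval_one {l : ℕ} (hl : 1 ≤ l) : (NB l).eval 1 = 0 := by
  have h := congrArg (eval 1) (NB_differential_equation hl)
  have hl' : l ≠ 0 := by omega
  simpa [hl'] using h

theorem NB_rodrigues {l : ℕ} (hl : 1 ≤ l) :
    C (l ! : ℝ) * NB l = (1 - X) * derivative^[l] (X ^ l * (1 - X) ^ (l - 1)) := by
  obtain ⟨n, rfl⟩ : ∃ n, l = n + 1 := ⟨l - 1, by omega⟩
  have hc (k : ℕ) : ((1 - X : ℝ[X]) ^ n).coeff k = (-1) ^ k * (n.choose k : ℝ) := by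
    have h : (1 - X : ℝ[X]) ^ n = ((1 + X) ^ n).comp (C (-1) * X) := by simp [sub_eq_add_neg]
    rw [h, comp_C_mul_X_coeff, coeff_one_add_X_pow, mul_comm]
  have hd (k : ℕ) : (derivative^[n + 1] (X ^ (n + 1) * (1 - X : ℝ[X]) ^ n)).coeff k
      = (n + 1)! * ((-1) ^ k * (n.choose k : ℝ) * ((n + 1 + k).choose k : ℝ)) := by
    rw [coeff_iterate_derivative, coeff_X_pow_mul, hc, Nat.descFactorial_eq_factorial_mul_choose,
      ← Nat.choose_symm_add, add_comm k]
    simp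
    ring
  ext k
  rw [coeff_C_mul, NB_coeff, sub_mul, one_mul, coeff_sub, Nat.add_sub_cancel, hd]
  rcases k with _ | k
  · simp
  · rw [coeff_X_mul, hd, show n + 1 + (k + 1) - 1 = n + 1 + k by omega,
      Nat.choose_succ_succ n k, show n + 1 + (k + 1) = (n + 1 + k) + 1 by omega,
      Nat.choose_succ_succ (n + 1 + k) k]
    have h₁ : (n.choose (k + 1) : ℝ) * (k + 1) = n.choose k * (n - k) :=
      cast_choose_succ_mul n k
    have h₂ : ((n + 1 + k).choose (k + 1) : ℝ) * (k + 1) = (n + 1 + k).choose k * (n + 1) := by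
      have h := cast_choose_succ_mul (n + 1 + k) k
      push_cast at h
      linear_combination h
    have h₃ : (n.choose k : ℝ) * (n + 1 + k).choose (k + 1)
        = (n.choose (k + 1) + n.choose k) * (n + 1 + k).choose k := by
      refine mul_right_cancel₀ (show (k : ℝ) + 1 ≠ 0 by positivity) ?_
      linear_combination (n.choose k : ℝ) * h₂ - ((n + 1 + k).choose k : ℝ) * h₁
    push_cast
    linear_combination ((n + 1)! : ℝ) * (-1) ^ (k + 1) * h₃

theorem rootSet_iterate_derivative_subset {s : Set ℂ} (hs : Convex ℝ s) {P : ℂ[X]}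
    (hP : P.rootSet ℂ ⊆ s) (n : ℕ) : (derivative^[n] P).rootSet ℂ ⊆ s := by
  induction n with
  | zero => exact hP
  | succ n ih =>
    rw [Function.iterate_succ_apply']
    rcases le_or_gt (derivative^[n] P).degree 0 with h | h
    · rw [eq_C_of_degree_le_zero h]
      simp
    · exact (rootSet_derivative_subset_convexHull_rootSet h).trans (convexHull_min ih hs)

theorem rootMultiplicity_le_one_of_differential_equation {K : Type*} [Field K] [CharZero K]
    {y : K[X]} {c r : K} (hr : r ≠ 0)
    (h : X * (1 - X) * derivative (derivative y) + (1 - X) * derivative y + C c * y = 0) :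
    y.rootMultiplicity r ≤ 1 := by
  rcases eq_or_ne y 0 with rfl | hy
  · simp
  by_contra! hm
  obtain ⟨g, hg, hdvd⟩ := exists_eq_pow_rootMultiplicity_mul_and_not_dvd y hy r
  obtain ⟨n, hn⟩ : ∃ n, y.rootMultiplicity r = n + 2 := ⟨y.rootMultiplicity r - 2, by omega⟩
  rw [hn] at hg
  have hgr : g.eval r ≠ 0 := fun h0 => hdvd (dvd_iff_isRoot.mpr h0)
  have hX : (X - C r : K[X]) ≠ 0 := X_sub_C_ne_zero r
  have hn1 : (n : K) + 1 ≠ 0 := by exact_mod_cast n.succ_ne_zero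
  have hn2 : (n : K) + 2 ≠ 0 := by exact_mod_cast (n + 1).succ_ne_zero
  have hd1 : derivative y = (X - C r) ^ (n + 1)
      * (((n : K[X]) + 2) * g + (X - C r) * derivative g) := by
    rw [hg]
    simp [derivative_pow, show C (2 : K) = 2 from map_ofNat C 2]
    ring
  have hd2 : derivative (derivative y) = (X - C r) ^ n * (((n : K[X]) + 1) * ((n : K[X]) + 2) * g
      + (X - C r) * (2 * ((n : K[X]) + 2) * derivative g + (X - C r) * derivative (derivative g))) := by
    rw [hd1]
    simp [derivative_pow]
    ring
  have key : X * (1 - X) * (((n : K[X]) + 1) * ((n : K[X]) + 2) * g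
      + (X - C r) * (2 * ((n : K[X]) + 2) * derivative g + (X - C r) * derivative (derivative g)))
      + (1 - X) * (X - C r) * (((n : K[X]) + 2) * g + (X - C r) * derivative g)
      + C c * (X - C r) ^ 2 * g = 0 := by
    refine mul_left_cancel₀ (pow_ne_zero n hX) ?_
    rw [hd2, hd1] at h
    linear_combination h - C c * hg
  rcases eq_or_ne r 1 with rfl | hr1
  · have key' : -X * (((n : K[X]) + 1) * ((n : K[X]) + 2) * g
        + (X - C 1) * (2 * ((n : K[X]) + 2) * derivative g + (X - C 1) * derivative (derivative g)))
        - (X - C 1) * (((n : K[X]) + 2) * g + (X - C 1) * derivative g)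
        + C c * (X - C 1) * g = 0 := by
      refine mul_left_cancel₀ hX ?_
      rw [C_1] at key ⊢
      linear_combination key
    have := congrArg (eval 1) key'
    simp [hn1, hn2, hgr] at this
  · have := congrArg (eval r) key
    simp [hn1, hn2, hgr, hr, sub_eq_zero, hr1.symm] at this

theorem NB_rootMultiplicity_le_one {l : ℕ} (hl : 1 ≤ l) {r : ℝ} (hr : r ≠ 0) :
    (NB l).rootMultiplicity r ≤ 1 :=
  rootMultiplicity_le_one_of_differential_equation hr (NB_differential_equation hl)

theorem NB_map_rootMultiplicity_le_one {l : ℕ} (hl : 1 ≤ l) {z : ℂ} (hz : z ≠ 0) :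
    ((NB l).map (algebraMap ℝ ℂ)).rootMultiplicity z ≤ 1 := by
  refine rootMultiplicity_le_one_of_differential_equation (c := (l : ℂ) ^ 2) hz ?_
  have h := congrArg (Polynomial.map (algebraMap ℝ ℂ)) (NB_differential_equation hl)
  simpa [derivative_map] using h

theorem NB_aeval_eq_zero {l : ℕ} (hl : 1 ≤ l) {z : ℂ} (hz : aeval z (NB l) = 0) :
    ∃ r : ℝ, (r : ℂ) = z ∧ r ∈ Set.Ioc (0 : ℝ) 1 := by
  have hNB : NB l ≠ 0 := fun h => by
    have := NB_natDegree hl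
    simp [h] at this
    omega
  have hmap : C (l ! : ℂ) * (NB l).map (algebraMap ℝ ℂ)
      = (1 - X) * derivative^[l] (X ^ l * (1 - X) ^ (l - 1)) := by
    have h := congrArg (Polynomial.map (algebraMap ℝ ℂ)) (NB_rodrigues hl)
    simpa [← iterate_derivative_map] using h
  have hne : derivative^[l] (X ^ l * (1 - X) ^ (l - 1) : ℂ[X]) ≠ 0 := fun h => by
    rw [h, mul_zero] at hmap
    simp [hNB, Nat.factorial_ne_zero] at hmap
  have h0 : z ≠ 0 := by
    rintro rfl
    rw [← coeff_zero_eq_aeval_zero'] at hz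
    simp [NB_coeff] at hz
  have hseg : z ∈ segment ℝ (0 : ℂ) 1 := by
    have h := congrArg (eval z) hmap
    rw [eval_mul, eval_map_algebraMap, hz, mul_zero, eval_mul, eq_comm, mul_eq_zero] at h
    rcases h with h | h
    · have : z = 1 := by simpa [sub_eq_zero, eq_comm (a := (1 : ℂ))] using h
      rw [this]
      exact right_mem_segment ℝ 0 1
    · refine rootSet_iterate_derivative_subset (convex_segment 0 1)
        (P := X ^ l * (1 - X) ^ (l - 1)) ?_ l ?_
      · intro w hw
        rw [mem_rootSet] at hw
        have hw' := hw.2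
        simp only [map_mul, map_pow, map_sub, map_one, aeval_X, mul_eq_zero] at hw'
        rcases hw' with hw' | hw'
        · rw [eq_zero_of_pow_eq_zero hw']
          exact left_mem_segment ℝ 0 1
        · rw [← sub_eq_zero.mp (eq_zero_of_pow_eq_zero hw')]
          exact right_mem_segment ℝ 0 1
      · rw [mem_rootSet]
        exact ⟨hne, by simpa using h⟩
  rw [segment_eq_image] at hseg
  obtain ⟨r, hr, rfl⟩ := hseg
  refine ⟨r, by simp, lt_of_le_of_ne hr.1 ?_, hr.2⟩
  rintro rfl
  simp at h0

/-- `N_{B_l}` has degree `l`, satisfies `N_{B_l}(1) = 0`, and has exactly `l` distinct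
real roots, all in `(0,1]`; every root is real, simple, and lies in `(0,1]`. -/
theorem roots_B (l : ℕ) (hl : 2 ≤ l) :
    (NB l).natDegree = l ∧ (NB l).eval 1 = 0 ∧
    ∃ S : Finset ℝ, S.card = l ∧ (∀ r ∈ S, r ∈ Set.Ioc (0 : ℝ) 1) ∧
      (∀ r : ℝ, (NB l).eval r = 0 ↔ r ∈ S) ∧
      (∀ r ∈ S, Polynomial.rootMultiplicity r (NB l) = 1) ∧
      (∀ z : ℂ, Polynomial.aeval z (NB l) = 0 → ∃ r : ℝ, (r : ℂ) = z ∧ r ∈ Set.Ioc (0 : ℝ) 1) := by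
  have hl1 : 1 ≤ l := by omega
  have hroot {r : ℝ} : (NB l).eval r = 0 ↔ aeval (r : ℂ) (NB l) = 0 := by
    rw [← Complex.coe_algebraMap, aeval_algebraMap_apply]
    simp [coe_aeval_eq_eval]
  have hdeg := NB_natDegree hl1
  have hNB : NB l ≠ 0 := fun h => by
    simp [h] at hdeg
    omega
  have hIoc {r : ℝ} (h : (NB l).eval r = 0) : r ∈ Set.Ioc (0 : ℝ) 1 := by
    obtain ⟨s, hs, hs'⟩ := NB_aeval_eq_zero hl1 (hroot.mp h)
    rwa [← Complex.ofReal_injective hs]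
  have hmem (r : ℝ) : (NB l).eval r = 0 ↔ r ∈ (NB l).roots.toFinset := by simp [hNB]
  refine ⟨hdeg, NB_eval_one hl1, (NB l).roots.toFinset, ?_, fun r hr => hIoc ((hmem r).mpr hr),
    hmem, ?_, fun z hz => NB_aeval_eq_zero hl1 hz⟩
  · set Q := (NB l).map (algebraMap ℝ ℂ) with hQ
    have hQ0 : Q ≠ 0 := by simpa [hQ] using hNB
    have hnodup : Q.roots.Nodup := by
      rw [Multiset.nodup_iff_count_le_one]
      intro z
      rw [count_roots]
      by_cases hz : aeval z (NB l) = 0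
      · obtain ⟨r, rfl, hr⟩ := NB_aeval_eq_zero hl1 hz
        exact NB_map_rootMultiplicity_le_one hl1 (by exact_mod_cast hr.1.ne')
      · rw [rootMultiplicity_eq_zero]
        · exact zero_le_one
        · rwa [IsRoot, hQ, eval_map_algebraMap]
    have himage : Q.roots.toFinset = (NB l).roots.toFinset.image ((↑) : ℝ → ℂ) := by
      ext z
      rw [Multiset.mem_toFinset, mem_roots hQ0, IsRoot, hQ, eval_map_algebraMap, Finset.mem_image]
      constructor
      · intro hz
        obtain ⟨r, rfl, hr⟩ := NB_aeval_eq_zero hl1 hz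
        exact ⟨r, (hmem r).mp (hroot.mpr hz), rfl⟩
      · rintro ⟨r, hr, rfl⟩
        exact hroot.mp ((hmem r).mpr hr)
    rw [← Finset.card_image_of_injective _ Complex.ofReal_injective, ← himage,
      Multiset.toFinset_card_of_nodup hnodup, ← (IsAlgClosed.splits Q).natDegree_eq_card_roots,
      hQ, natDegree_map, hdeg]
  · intro r hr
    have hr' := (hmem r).mpr hr
    exact le_antisymm (NB_rootMultiplicity_le_one hl1 (hIoc hr').1.ne')
      ((rootMultiplicity_pos hNB).mpr hr')
end

section
/- For every integer l ≥ 4, the polynomial N_{D_l} has degree l, satisfies N_{D_l}(1) = 0, and has exactly l distinct real roots, all of which lie in the half-open interval (0,1]; consequently every root of N_{D_l} is real, simple, and lies in (0,1]. -/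
open Polynomial

/-- The skew-growth function of the dual Artin monoid of type `D_l`:
`N_{D_l}(t) = ∑_{k=0}^{l} (−1)^k·(C(l,k)·C(l+k−2,k) + C(l−2,k−2)·C(l+k−3,k))·t^k`,
with the convention `C(n,j) = 0` for `j < 0`. -/
noncomputable def ND (l : ℕ) : Polynomial ℝ :=
  ∑ k ∈ Finset.range (l + 1),
    Polynomial.C ((-1 : ℝ) ^ k * ((l.choose k : ℝ) * ((l + k - 2).choose k : ℝ) +
      (if 2 ≤ k then ((l - 2).choose (k - 2) : ℝ) * ((l + k - 3).choose k : ℝ) else 0))) * X ^ k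

/-- `P` vanishes at points `x 1 < ⋯ < x k` of `(0, 1)`, at which `Q` alternates in sign, being
positive at `x 1`. -/
def AlternatesAtZeros (k : ℕ) (P Q : ℝ[X]) : Prop :=
  ∃ x : ℕ → ℝ, x 0 = 0 ∧ x (k + 1) = 1 ∧ StrictMonoOn x (Set.Iic (k + 1)) ∧
    ∀ i < k, P.eval (x (i + 1)) = 0 ∧ 0 < (-1) ^ i * Q.eval (x (i + 1))

theorem neg_one_pow_mul_prod_sub_pos {x : ℕ → ℝ} {y : ℝ} {i k : ℕ} (hik : i ≤ k)
    (h₁ : ∀ j < i, x j < y) (h₂ : ∀ j, i ≤ j → j < k → y < x j) :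
    0 < (-1) ^ i * ∏ j ∈ Finset.range k, (x j - y) := by
  obtain ⟨d, rfl⟩ := Nat.exists_eq_add_of_le hik
  rw [Finset.prod_range_add, ← mul_assoc]
  refine mul_pos ?_ (Finset.prod_pos fun j hj => ?_)
  · have : (-1 : ℝ) ^ i * ∏ j ∈ Finset.range i, (x j - y) = ∏ j ∈ Finset.range i, (y - x j) := by
      nth_rewrite 1 [← Finset.card_range i]
      rw [← Finset.prod_const, ← Finset.prod_mul_distrib]
      exact Finset.prod_congr rfl fun j _ => by ring
    rw [this]
    exact Finset.prod_pos fun j hj => sub_pos.2 (h₁ j (Finset.mem_range.1 hj))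
  · exact sub_pos.2 (h₂ _ (by omega) (by simpa using hj))

/-- A polynomial of degree at most `k` with `k` distinct roots is a multiple of the product of the
corresponding linear factors. -/
theorem exists_eval_eq_mul_prod_sub {P : ℝ[X]} {k : ℕ} (hP : P.natDegree ≤ k) {x : ℕ → ℝ}
    (hx : Set.InjOn x (Finset.range k)) (h0 : ∀ i < k, P.eval (x i) = 0) :
    ∃ c : ℝ, ∀ y, P.eval y = c * ∏ j ∈ Finset.range k, (x j - y) := by
  have hdvd : (∏ j ∈ Finset.range k, (X - C (x j))) ∣ P := by
    refine Finset.prod_dvd_of_coprime (fun a ha b hb hab => ?_) fun j hj => ?_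
    · exact isCoprime_X_sub_C_of_isUnit_sub (sub_ne_zero.2 (hx.ne ha hb hab)).isUnit
    · exact dvd_iff_isRoot.2 (h0 j (Finset.mem_range.1 hj))
  obtain ⟨q, hq⟩ := hdvd
  have hmonic : (∏ j ∈ Finset.range k, (X - C (x j))).Monic :=
    monic_prod_of_monic _ _ fun j _ => monic_X_sub_C _
  have hdeg : (∏ j ∈ Finset.range k, (X - C (x j))).natDegree = k := by
    rw [natDegree_prod_of_monic _ _ fun j _ => monic_X_sub_C _]
    simp
  have hq0 : q.natDegree = 0 := by
    by_cases h : q = 0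
    · simp [h]
    · have := hmonic.natDegree_mul' h
      rw [← hq, hdeg] at this
      omega
  obtain ⟨c, rfl⟩ := natDegree_eq_zero.1 hq0
  refine ⟨c * (-1) ^ k, fun y => ?_⟩
  have : (-1 : ℝ) ^ k * ∏ j ∈ Finset.range k, (x j - y) = ∏ j ∈ Finset.range k, (y - x j) := by
    nth_rewrite 1 [← Finset.card_range k]
    rw [← Finset.prod_const, ← Finset.prod_mul_distrib]
    exact Finset.prod_congr rfl fun j _ => by ring
  rw [mul_assoc, this, hq]
  simp [eval_prod, mul_comm]

theorem exists_eval_eq_zero_of_signs {G : ℝ[X]} {a b s : ℝ} (hab : a < b)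
    (ha : 0 < s * G.eval a) (hb : 0 < -s * G.eval b) : ∃ y ∈ Set.Ioo a b, G.eval y = 0 := by
  have hs : s ≠ 0 := by rintro rfl; simp at ha
  obtain ⟨y, hy, h⟩ := intermediate_value_Ioo' (f := fun y => s * G.eval y) hab.le
    (by fun_prop) (show (0 : ℝ) ∈ Set.Ioo _ _ from ⟨by linarith, ha⟩)
  exact ⟨y, hy, (mul_eq_zero.1 h).resolve_left hs⟩

theorem AlternatesAtZeros.step {k : ℕ} {P Q : ℝ[X]} (h : AlternatesAtZeros k P Q)
    (hdeg : P.natDegree ≤ k) (hP0 : 0 < P.eval 0) (L : ℝ[X]) {c : ℝ} (hc : 0 < c)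
    (hG0 : 0 < (L * P - C c * Q).eval 0)
    (hG1 : 0 < (-1) ^ (k + 1) * (L * P - C c * Q).eval 1) :
    AlternatesAtZeros (k + 1) (L * P - C c * Q) P := by
  obtain ⟨x, hx0, hx1, hmono, hx⟩ := h
  set G := L * P - C c * Q with hG
  have hsign : ∀ i ≤ k + 1, 0 < (-1) ^ i * G.eval (x i) := by
    intro i hi
    rcases i with _ | i
    · simpa [hx0] using hG0
    rcases Nat.lt_or_ge i k with hik | hik
    · obtain ⟨h1, h2⟩ := hx i hik
      have : (-1) ^ (i + 1) * G.eval (x (i + 1)) = c * ((-1) ^ i * Q.eval (x (i + 1))) := by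
        simp only [hG, eval_sub, eval_mul, eval_C, h1]
        ring
      rw [this]
      positivity
    · obtain rfl : i = k := by omega
      rwa [hx1]
  have hlt : ∀ {i j}, i < j → j ≤ k + 1 → x i < x j := fun {i j} hij hj =>
    hmono (Set.mem_Iic.2 (by omega)) (Set.mem_Iic.2 hj) hij
  have hle : ∀ {i j}, i ≤ j → j ≤ k + 1 → x i ≤ x j := fun {i j} hij hj =>
    hmono.monotoneOn (Set.mem_Iic.2 (by omega)) (Set.mem_Iic.2 hj) hij
  have hroot : ∀ i, ∃ y, i ≤ k → y ∈ Set.Ioo (x i) (x (i + 1)) ∧ G.eval y = 0 := by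
    intro i
    by_cases hi : i ≤ k
    · obtain ⟨y, hy⟩ := exists_eval_eq_zero_of_signs (hlt (Nat.lt_succ_self i) (by omega))
        (hsign i (by omega)) (by simpa [pow_succ] using hsign (i + 1) (by omega))
      exact ⟨y, fun _ => hy⟩
    · exact ⟨0, fun h => absurd h hi⟩
  choose y hy using hroot
  obtain ⟨a, ha⟩ := exists_eval_eq_mul_prod_sub hdeg (x := fun i => x (i + 1))
    (fun i hi j hj hij => by
      have := hmono.injOn (Set.mem_Iic.2 (by simp at hi; omega))
        (Set.mem_Iic.2 (by simp at hj; omega)) hij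
      omega) (fun i hi => (hx i hi).1)
  have hapos : 0 < a := by
    have h0 : 0 < ∏ j ∈ Finset.range k, (x (j + 1) - 0) := Finset.prod_pos fun j hj => by
      have := hlt (Nat.succ_pos j) (by simp at hj; omega)
      simpa [hx0] using this
    rw [ha 0] at hP0
    exact (pos_iff_pos_of_mul_pos hP0).2 h0
  refine ⟨fun i => if i = 0 then 0 else if i ≤ k + 1 then y (i - 1) else 1, by simp, by simp,
    strictMonoOn_Iic_of_lt_succ fun i hi => ?_, fun i hi => ?_⟩
  · rcases i with _ | i
    · simpa [hx0] using (hy 0 (by omega)).1.1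
    · rcases Nat.lt_or_ge i k with hik | hik
      · simpa [hik, hik.le] using (hy i hik.le).1.2.trans (hy (i + 1) hik).1.1
      · obtain rfl : i = k := by omega
        simpa [hx1] using (hy i le_rfl).1.2
  · have hi' : i ≤ k := by omega
    simp only [Nat.succ_ne_zero, if_false, Nat.add_sub_cancel, if_pos (Nat.succ_le_succ hi')]
    obtain ⟨⟨h1, h2⟩, h3⟩ := hy i hi'
    refine ⟨h3, ?_⟩
    rw [ha, mul_left_comm]
    refine mul_pos hapos (neg_one_pow_mul_prod_sub_pos hi' (fun j hj => ?_) fun j hj hjk => ?_)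
    · exact (hle hj (by omega)).trans_lt h1
    · exact h2.trans_le (hle (by omega) (by omega))

/-- The Jacobi polynomials for the weight `1 - t` on `[0, 1]`, with constant coefficient `1`. -/
noncomputable def jacobiOneZero : ℕ → ℝ[X]
  | 0 => 1
  | 1 => 1 - C 3 * X
  | m + 2 =>
    (C (1 + (2 * m + 5) * (m + 1) / ((m + 3) * (2 * m + 3)) : ℝ) - C (2 * (2 * m + 5) / (m + 3) : ℝ) * X) *
        jacobiOneZero (m + 1) -
      C ((2 * m + 5) * (m + 1) / ((m + 3) * (2 * m + 3)) : ℝ) * jacobiOneZero m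

theorem jacobiOneZero_eval_zero (m : ℕ) : (jacobiOneZero m).eval 0 = 1 := by
  induction m using jacobiOneZero.induct with
  | case1 => simp [jacobiOneZero]
  | case2 => simp [jacobiOneZero]
  | case3 m h1 h2 => simp [jacobiOneZero, h1, h2]

theorem jacobiOneZero_eval_one (m : ℕ) : (jacobiOneZero m).eval 1 = (-1) ^ m * (m + 1) := by
  induction m using jacobiOneZero.induct with
  | case1 => simp [jacobiOneZero]
  | case2 => simp [jacobiOneZero]; norm_num
  | case3 m h1 h2 =>
    simp only [jacobiOneZero, h1, h2, eval_sub, eval_mul, eval_C, eval_X, Nat.cast_add,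
      Nat.cast_one]
    rw [show m.succ.succ = m + 2 from rfl]
    push_cast
    field_simp
    ring

theorem natDegree_jacobiOneZero_le (m : ℕ) : (jacobiOneZero m).natDegree ≤ m := by
  induction m using jacobiOneZero.induct with
  | case1 => simp [jacobiOneZero]
  | case2 => rw [jacobiOneZero]; compute_degree
  | case3 m h1 h2 =>
    rw [jacobiOneZero]
    refine (natDegree_sub_le _ _).trans (max_le ?_ ?_)
    · rw [show m.succ.succ = 1 + (m + 1) by omega]
      exact natDegree_mul_le_of_le (by compute_degree) h1
    · exact (natDegree_C_mul_le _ _).trans (by omega)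

theorem alternatesAtZeros_jacobiOneZero (m : ℕ) :
    AlternatesAtZeros (m + 1) (jacobiOneZero (m + 1)) (jacobiOneZero m) := by
  induction m with
  | zero =>
    refine ⟨fun i => if i = 0 then 0 else if i = 1 then 1 / 3 else 1, by simp, by simp,
      strictMonoOn_Iic_of_lt_succ fun i hi => ?_, fun i hi => ?_⟩
    · interval_cases i <;> norm_num
    · interval_cases i
      simp [jacobiOneZero]
  | succ m ih =>
    have h0 := jacobiOneZero_eval_zero (m + 2)
    have h1 := jacobiOneZero_eval_one (m + 2)
    rw [jacobiOneZero] at h0 h1 ⊢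
    refine ih.step (natDegree_jacobiOneZero_le _) (by simp [jacobiOneZero_eval_zero]) _
      (by positivity) (one_pos.trans_eq h0.symm) ?_
    rw [h1, ← mul_assoc, ← pow_add, Even.neg_one_pow ⟨m + 2, by ring⟩]
    positivity

theorem cast_succ_choose_succ (n k : ℕ) :
    ((n + 1).choose (k + 1) : ℝ) = n.choose k * (n + 1) / (k + 1) := by
  have := Nat.add_one_mul_choose_eq n k
  rw [eq_div_iff (by positivity)]
  exact_mod_cast (by linarith : (n + 1).choose (k + 1) * (k + 1) = n.choose k * (n + 1))

theorem cast_choose_succ (n k : ℕ) :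
    (n.choose (k + 1) : ℝ) = n.choose k * (n - k) / (k + 1) := by
  have h1 := cast_succ_choose_succ n k
  rw [Nat.choose_succ_succ] at h1
  push_cast at h1
  rw [eq_sub_of_add_eq' h1]
  field_simp
  ring

theorem cast_choose_of_succ (n k : ℕ) :
    (n.choose k : ℝ) = (n + 1).choose k * (n + 1 - k) / (n + 1) := by
  cases k with
  | zero => simp; field_simp
  | succ k =>
    rw [cast_choose_succ, cast_succ_choose_succ]
    push_cast
    field_simp
    ring

theorem coeff_one_sub_X_mul_jacobiOneZero (m k : ℕ) :
    ((1 - X) * jacobiOneZero m).coeff k =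
      (-1 : ℝ) ^ k * ((m + 1).choose k * (m + k).choose k) := by
  induction m using jacobiOneZero.induct generalizing k with
  | case1 =>
    rcases k with _ | _ | k <;>
      simp [jacobiOneZero, coeff_X, coeff_one, Nat.choose_eq_zero_of_lt]
  | case2 =>
    have : (1 - X) * jacobiOneZero 1 = 1 - C 4 * X + C 3 * X ^ 2 := by
      rw [jacobiOneZero, show (4 : ℝ) = 1 + 3 by norm_num, C_add, C_1]
      ring
    rw [this]
    rcases k with _ | _ | _ | k <;>
      simp [coeff_X, coeff_one, coeff_X_pow, Nat.choose_eq_zero_of_lt]; norm_num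
  | case3 m h1 h2 =>
    have key : ∀ a b c : ℝ, (1 - X) * ((C a - C b * X) * jacobiOneZero (m + 1) -
        C c * jacobiOneZero m) = C a * ((1 - X) * jacobiOneZero (m + 1)) -
        C b * (X * ((1 - X) * jacobiOneZero (m + 1))) - C c * ((1 - X) * jacobiOneZero m) := by
      intros; ring
    rw [jacobiOneZero, key]
    rcases k with _ | j
    · simp only [coeff_sub, coeff_C_mul, coeff_X_mul_zero, h1, h2]
      simp
    · simp only [coeff_sub, coeff_C_mul, coeff_X_mul, h1, h2]
      have e1 := cast_succ_choose_succ (m + 2) j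
      have e2 := cast_choose_succ (m + 2) j
      have e3 := cast_choose_of_succ (m + 1) (j + 1)
      have f1 := cast_choose_succ (m + 1 + j) j
      have f2 := cast_succ_choose_succ (m + 1 + j) j
      have f3 := cast_succ_choose_succ (m + 2 + j) j
      have f4 := cast_choose_of_succ (m + 1 + j) j
      rw [show m.succ.succ + 1 = m + 2 + 1 by omega, show m + 1 + 1 = m + 2 by omega,
        show m.succ.succ + (j + 1) = m + 2 + j + 1 by omega,
        show m + 1 + (j + 1) = m + 1 + j + 1 by omega,
        show m + (j + 1) = m + 1 + j by omega]
      rw [show m + 2 + j = m + 1 + j + 1 by omega] at f3 ⊢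
      rw [f3, e3, e1, e2, f2, f1, f4]
      push_cast
      field_simp
      ring

theorem coeff_ND (n k : ℕ) :
    (ND (n + 3)).coeff k = (-1 : ℝ) ^ k * ((n + 3).choose k * (n + 1 + k).choose k +
      (n + 3).choose k * (k * (k - 1)) / ((n + 3) * (n + 2)) * (n + k).choose k) := by
  have hcoeff : (ND (n + 3)).coeff k = if k < n + 3 + 1 then
      (-1 : ℝ) ^ k * (((n + 3).choose k : ℝ) * ((n + 3 + k - 2).choose k : ℝ) +
        (if 2 ≤ k then ((n + 3 - 2).choose (k - 2) : ℝ) * ((n + 3 + k - 3).choose k : ℝ) else 0))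
      else 0 := by
    simp only [ND, finsetSum_coeff, coeff_C_mul, coeff_X_pow, mul_ite, mul_one, mul_zero,
      Finset.sum_ite_eq, Finset.mem_range]
  rw [hcoeff]
  split_ifs with h1 h2
  · obtain ⟨j, rfl⟩ := Nat.exists_eq_add_of_le' h2
    rw [show n + 3 + (j + 2) - 2 = n + 1 + (j + 2) by omega,
      show n + 3 + (j + 2) - 3 = n + (j + 2) by omega, show n + 3 - 2 = n + 1 by omega,
      Nat.add_sub_cancel]
    have e1 := cast_succ_choose_succ (n + 2) (j + 1)
    have e2 := cast_succ_choose_succ (n + 1) j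
    rw [show n + 3 = n + 2 + 1 by omega, show j + 2 = j + 1 + 1 by omega, e1, e2]
    push_cast
    field_simp
    ring
  · have hk : (k : ℝ) * (k - 1) = 0 := by
      interval_cases k <;> simp
    rw [hk, show n + 3 + k - 2 = n + 1 + k by omega]
    simp
  · rw [Nat.choose_eq_zero_of_lt (show n + 3 < k by omega)]
    simp

theorem ND_eq_mul (n : ℕ) :
    ND (n + 3) = (1 - X) *
      ((C (1 + (n + 1) ^ 2 / ((n + 3) * (2 * n + 3)) : ℝ) - C ((3 * n + 5) / (n + 3) : ℝ) * X) *
        jacobiOneZero (n + 1) - C ((n + 1) ^ 2 / ((n + 3) * (2 * n + 3)) : ℝ) * jacobiOneZero n) := by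
  have key : ∀ a b c : ℝ, (1 - X) * ((C a - C b * X) * jacobiOneZero (n + 1) -
      C c * jacobiOneZero n) = C a * ((1 - X) * jacobiOneZero (n + 1)) -
      C b * (X * ((1 - X) * jacobiOneZero (n + 1))) - C c * ((1 - X) * jacobiOneZero n) := by
    intros; ring
  rw [key]
  ext k
  rw [coeff_ND]
  rcases k with _ | j
  · simp only [coeff_sub, coeff_C_mul, coeff_X_mul_zero, coeff_one_sub_X_mul_jacobiOneZero]
    simp
  · simp only [coeff_sub, coeff_C_mul, coeff_X_mul, coeff_one_sub_X_mul_jacobiOneZero]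
    have e1 := cast_succ_choose_succ (n + 2) j
    have e2 := cast_choose_succ (n + 2) j
    have e3 := cast_choose_of_succ (n + 1) (j + 1)
    have f1 := cast_choose_succ (n + 1 + j) j
    have f2 := cast_succ_choose_succ (n + 1 + j) j
    rw [show n + 3 = n + 2 + 1 by omega, show n + 1 + 1 = n + 2 by omega,
      show n + 1 + (j + 1) = n + 1 + j + 1 by omega,
      show n + (j + 1) = n + 1 + j by omega, e3, e1, e2, f2, f1]
    push_cast
    field_simp
    ring

theorem natDegree_ND (n : ℕ) : (ND (n + 3)).natDegree = n + 3 := by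
  refine natDegree_eq_of_le_of_coeff_ne_zero ?_ ?_
  · rw [natDegree_le_iff_coeff_eq_zero]
    intro k hk
    rw [coeff_ND, Nat.choose_eq_zero_of_lt hk]
    simp
  · rw [coeff_ND]
    have h : (0 : ℝ) < (n + 1 + (n + 3)).choose (n + 3) := by
      exact_mod_cast Nat.choose_pos (by omega)
    have h' : (0 : ℝ) ≤ ((n + 3 : ℕ) : ℝ) - 1 := by
      push_cast
      linarith [(Nat.cast_nonneg n : (0 : ℝ) ≤ n)]
    refine mul_ne_zero (by simp) (ne_of_gt ?_)
    rw [Nat.choose_self]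
    positivity

/-- Apart from `1`, the polynomial `N_{D_{n+3}}` has `n + 2` roots in `(0, 1)`. -/
theorem exists_strictMonoOn_roots_ND (n : ℕ) : ∃ x : ℕ → ℝ, x 0 = 0 ∧ x (n + 3) = 1 ∧
    StrictMonoOn x (Set.Iic (n + 3)) ∧ ∀ i < n + 3, (ND (n + 3)).eval (x (i + 1)) = 0 := by
  obtain ⟨x, hx0, hx1, hmono, hx⟩ := (alternatesAtZeros_jacobiOneZero n).step
    (natDegree_jacobiOneZero_le _) (by simp [jacobiOneZero_eval_zero])
    (C (1 + (n + 1) ^ 2 / ((n + 3) * (2 * n + 3)) : ℝ) - C ((3 * n + 5) / (n + 3) : ℝ) * X)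
    (c := (n + 1) ^ 2 / ((n + 3) * (2 * n + 3))) (by positivity)
    (by simp [jacobiOneZero_eval_zero])
    (by
      have h : ((-1 : ℝ) ^ n) ^ 2 = 1 := by rw [← pow_mul, mul_comm, pow_mul]; simp
      simp only [eval_sub, eval_mul, eval_C, eval_X, jacobiOneZero_eval_one]
      have : (0 : ℝ) < ((-1 : ℝ) ^ n) ^ 2 * (n + 1) := by rw [h]; positivity
      convert this using 1
      push_cast
      field_simp
      ring)
  refine ⟨x, hx0, hx1, hmono, fun i hi => ?_⟩
  rw [ND_eq_mul, eval_mul]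
  rcases Nat.lt_or_ge i (n + 2) with h | h
  · rw [(hx i h).1, mul_zero]
  · obtain rfl : i = n + 2 := by omega
    rw [hx1]
    simp

theorem roots_eq_val_of_card_eq_natDegree_s10 {P : ℝ[X]} (hP : P ≠ 0) {S : Finset ℝ}
    (hS : ∀ r ∈ S, P.eval r = 0) (hcard : S.card = P.natDegree) : P.roots = S.val := by
  refine (Multiset.eq_of_le_of_card_le ?_ ?_).symm
  · exact (Multiset.le_iff_subset S.nodup).2 fun r hr => (mem_roots hP).2 (hS r hr)
  · exact (card_roots' P).trans hcard.ge

/-- `N_{D_l}` has degree `l`, satisfies `N_{D_l}(1) = 0`, and has exactly `l` distinct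
real roots, all in `(0,1]`; every root is real, simple, and lies in `(0,1]`. -/
theorem roots_D (l : ℕ) (hl : 4 ≤ l) :
    (ND l).natDegree = l ∧ (ND l).eval 1 = 0 ∧
    ∃ S : Finset ℝ, S.card = l ∧ (∀ r ∈ S, r ∈ Set.Ioc (0 : ℝ) 1) ∧
      (∀ r : ℝ, (ND l).eval r = 0 ↔ r ∈ S) ∧
      (∀ r ∈ S, Polynomial.rootMultiplicity r (ND l) = 1) ∧
      (∀ z : ℂ, Polynomial.aeval z (ND l) = 0 → ∃ r : ℝ, (r : ℂ) = z ∧ r ∈ Set.Ioc (0 : ℝ) 1) := by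
  obtain ⟨n, rfl⟩ := Nat.exists_eq_add_of_le' (show 3 ≤ l by omega)
  obtain ⟨x, hx0, hx1, hmono, hx⟩ := exists_strictMonoOn_roots_ND n
  have hdeg := natDegree_ND n
  have hne : ND (n + 3) ≠ 0 := by
    intro h
    rw [h, natDegree_zero] at hdeg
    omega
  set S : Finset ℝ := (Finset.range (n + 3)).image fun i => x (i + 1) with hS
  have hcard : S.card = n + 3 := by
    rw [hS, Finset.card_image_of_injOn, Finset.card_range]
    intro i hi j hj hij
    simp only [Finset.coe_range, Set.mem_Iio] at hi hj
    have := hmono.injOn (Set.mem_Iic.2 (by omega)) (Set.mem_Iic.2 (by omega)) hij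
    omega
  have hroots : (ND (n + 3)).roots = S.val := by
    refine roots_eq_val_of_card_eq_natDegree_s10 hne (fun r hr => ?_) (hcard.trans hdeg.symm)
    obtain ⟨i, hi, rfl⟩ := Finset.mem_image.1 hr
    exact hx i (Finset.mem_range.1 hi)
  have hIoc : ∀ r ∈ S, r ∈ Set.Ioc (0 : ℝ) 1 := by
    intro r hr
    obtain ⟨i, hi, rfl⟩ := Finset.mem_image.1 hr
    rw [Finset.mem_range] at hi
    rw [← hx0, ← hx1]
    exact ⟨hmono (Set.mem_Iic.2 (by omega)) (Set.mem_Iic.2 (by omega)) (by omega),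
      hmono.monotoneOn (Set.mem_Iic.2 (by omega)) (Set.mem_Iic.2 le_rfl) (by omega)⟩
  refine ⟨hdeg, ?_, S, hcard, hIoc, fun r => ?_, fun r hr => ?_, fun z hz => ?_⟩
  · rw [← hx1]
    exact hx (n + 2) (by omega)
  · rw [← Finset.mem_val, ← hroots, mem_roots hne, IsRoot.def]
  · rw [← count_roots, hroots]
    exact Multiset.count_eq_one_of_mem S.nodup hr
  · have hfac := C_leadingCoeff_mul_prod_multiset_X_sub_C (p := ND (n + 3))
      (by rw [hroots, hdeg]; exact hcard)
    rw [hroots] at hfac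
    change C _ * ∏ r ∈ S, (X - C r) = _ at hfac
    rw [← hfac, map_mul, map_prod, mul_eq_zero, aeval_C, Finset.prod_eq_zero_iff] at hz
    rcases hz with hz | ⟨r, hr, hz⟩
    · exact absurd hz (by simpa using hne)
    · refine ⟨r, ?_, hIoc r hr⟩
      simpa [sub_eq_zero, eq_comm] using hz
end
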